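/- arXiv:math/0701001 — 2 statements merged into one kernel-verified Lean document; each statement's English description precedes it below -/
import Mathlib

section
/- Let f(x,y) = ux + vy be a binary linear form with integer coefficients satisfying u ≥ |v| ≥ 1 and gcd(u,v) = 1, and suppose |uv| is not a perfect square. Then there exist finite sets A and A' of integers such that |f(A)| < |A + A| and |f(A')| < |A' − A'|. -/
open Pointwise

/-- The image of a finite set `A` of integers under the binary linear form
`f(x,y) = u x + v y`. -/
def binFormImage (u v : ℤ) (A : Finset ℤ) : Finset ℤ :=
  (A ×ˢ A).image fun p => u * p.1 + v * p.2

open ArithmeticFunction.vonMangoldt Filter Topology in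
theorem not_summable_inv_prime_residueClass {q : ℕ} [NeZero q] {a : ZMod q} (ha : IsUnit a) :
    ¬ Summable ({p : ℕ | p.Prime ∧ (p : ZMod q) = a}.indicator fun p ↦ (p : ℝ)⁻¹) := by
  intro H
  obtain ⟨C, hC⟩ := LSeries_residueClass_lower_bound ha
  set g : ℕ → ℝ := {p : ℕ | p.Prime ∧ (p : ZMod q) = a}.indicator fun p ↦ (p : ℝ)⁻¹ with hg
  have hI : Set.Ioc (1 : ℝ) 2 ∈ 𝓝[>] (1 : ℝ) := Ioc_mem_nhdsGT one_lt_two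
  have hx1 : Tendsto (fun x : ℝ ↦ x - 1) (𝓝[>] 1) (𝓝 0) := by
    have : Tendsto (fun x : ℝ ↦ x - 1) (𝓝 1) (𝓝 (1 - 1)) := tendsto_id.sub_const 1
    rw [sub_self] at this
    exact this.mono_left nhdsWithin_le_nhds
  have key : Tendsto (fun x : ℝ ↦ ∑' n : ℕ, (x - 1) * (residueClass a n / (n : ℝ) ^ x))
      (𝓝[>] 1) (𝓝 (∑' _ : ℕ, (0 : ℝ))) := by
    refine tendsto_tsum_of_dominated_convergence
      (H.add (summable_residueClass_non_primes_div a)) (fun n ↦ ?_) ?_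
    · rcases n.eq_zero_or_pos with rfl | hn
      · simp
      · have h0 : (0 : ℝ) < n := mod_cast hn
        have : Tendsto (fun x : ℝ ↦ (x - 1) * (residueClass a n / (n : ℝ) ^ x)) (𝓝[>] 1)
            (𝓝 (0 * (residueClass a n / (n : ℝ) ^ (1 : ℝ)))) := by
          refine hx1.mul (Tendsto.mono_left ?_ nhdsWithin_le_nhds)
          exact tendsto_const_nhds.div ((Real.continuousAt_const_rpow h0.ne').tendsto)
            (Real.rpow_pos_of_pos h0 _).ne'
        simpa using this
    · filter_upwards [hI] with x hx n
      rcases n.eq_zero_or_pos with rfl | hn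
      · simp [hg, Set.indicator]
      have h0 : (0 : ℝ) < n := mod_cast hn
      have h1 : (1 : ℝ) ≤ n := mod_cast hn
      have hs : 0 < x - 1 := sub_pos.mpr hx.1
      have hr := residueClass_nonneg a n
      have hpow : (n : ℝ) ^ x = n * (n : ℝ) ^ (x - 1) := by
        rw [← Real.rpow_one_add' h0.le (by linarith [hx.1])]; ring_nf
      have hnn : 0 ≤ (x - 1) * (residueClass a n / (n : ℝ) ^ x) := by positivity
      rw [Real.norm_of_nonneg hnn]
      by_cases hp : n.Prime
      · simp only [hp, if_true, zero_div, add_zero]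
        by_cases hna : (n : ZMod q) = a
        · have e1 : residueClass a n = Real.log n := by
            simp [residueClass, Set.indicator, hna,
              ArithmeticFunction.vonMangoldt_apply_prime hp]
          have e2 : g n = (n : ℝ)⁻¹ := by simp [hg, hna, hp]
          have hlog := Real.log_le_rpow_div h0.le hs
          rw [le_div_iff₀ hs] at hlog
          rw [e1, e2, hpow, mul_div_assoc', div_le_iff₀ (by positivity)]
          field_simp
          linarith
        · have e1 : residueClass a n = 0 := by simp [residueClass, Set.indicator, hna]
          rw [e1]; simp [hg, hna]
      · have e2 : g n = 0 := by simp [hg, hp]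
        simp only [hp, if_false, e2, zero_add]
        have hle : (n : ℝ) ≤ (n : ℝ) ^ x := by
          conv_lhs => rw [← Real.rpow_one n]
          exact Real.rpow_le_rpow_of_exponent_le h1 hx.1.le
        calc _ ≤ 1 * (residueClass a n / (n : ℝ) ^ x) := by
              gcongr
              linarith [hx.2]
          _ ≤ _ := by rw [one_mul]; gcongr
  rw [tsum_zero] at key
  have hlim : Tendsto (fun x : ℝ ↦ (q.totient : ℝ)⁻¹ - C * (x - 1)) (𝓝[>] 1)
      (𝓝 (q.totient : ℝ)⁻¹) := by
    simpa using (hx1.const_mul C).const_sub (q.totient : ℝ)⁻¹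
  have hle : (q.totient : ℝ)⁻¹ ≤ 0 := by
    refine le_of_tendsto_of_tendsto hlim key ?_
    filter_upwards [hI] with x hx
    have hs : 0 < x - 1 := sub_pos.mpr hx.1
    rw [tsum_mul_left]
    have := mul_le_mul_of_nonneg_left (hC hx) hs.le
    refine le_trans (le_of_eq ?_) this
    field_simp
  have hq : 0 < (q.totient : ℝ)⁻¹ := inv_pos.mpr (mod_cast q.totient.pos_of_neZero)
  linarith

theorem totient_prod_primes_le (P : Finset ℕ) (hP : ∀ p ∈ P, p.Prime) :
    ((∏ p ∈ P, p).totient : ℝ) ≤ (∏ p ∈ P, p : ℕ) * Real.exp (-∑ p ∈ P, (p : ℝ)⁻¹) := by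
  induction P using Finset.induction_on with
  | empty => simp
  | insert p s hps ih =>
    have hp := hP p (Finset.mem_insert_self _ _)
    have hs : ∀ r ∈ s, r.Prime := fun r hr ↦ hP r (Finset.mem_insert_of_mem hr)
    have hc : p.Coprime (∏ r ∈ s, r) := Nat.Coprime.prod_right fun r hr ↦
      (Nat.coprime_primes hp (hs r hr)).mpr fun h ↦ hps (h ▸ hr)
    rw [Finset.prod_insert hps, Finset.sum_insert hps, Nat.totient_mul hc,
      Nat.totient_prime hp, neg_add, Real.exp_add]
    push_cast [hp.one_le]
    have h0 : (0 : ℝ) < p := mod_cast hp.pos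
    have h1 : (p : ℝ) - 1 ≤ p * Real.exp (-(p : ℝ)⁻¹) := by
      have := mul_le_mul_of_nonneg_left (Real.add_one_le_exp (-(p : ℝ)⁻¹)) h0.le
      refine le_trans (le_of_eq ?_) this
      field_simp
      ring
    have h2 := ih hs
    push_cast at h2
    calc _ ≤ (p * Real.exp (-(p : ℝ)⁻¹)) *
          ((∏ r ∈ s, (r : ℝ)) * Real.exp (-∑ r ∈ s, (r : ℝ)⁻¹)) := by gcongr
      _ = _ := by ring

theorem exists_primes_residueClass_mul_totient_lt {q : ℕ} [NeZero q] {a : ZMod q}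
    (ha : IsUnit a) (N C : ℕ) :
    ∃ P : Finset ℕ, (∀ p ∈ P, p.Prime ∧ (p : ZMod q) = a ∧ N < p) ∧
      C * (∏ p ∈ P, p).totient < ∏ p ∈ P, p := by
  set g : ℕ → ℝ := {p : ℕ | p.Prime ∧ (p : ZMod q) = a}.indicator fun p ↦ (p : ℝ)⁻¹ with hg
  have hg0 : ∀ n, 0 ≤ g n := fun n ↦ Set.indicator_apply_nonneg fun _ ↦ by positivity
  have hns : ¬ Summable fun n ↦ g (n + (N + 1)) := by
    rw [summable_nat_add_iff]
    exact not_summable_inv_prime_residueClass ha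
  have htop := (not_summable_iff_tendsto_nat_atTop_of_nonneg fun n ↦ hg0 _).mp hns
  obtain ⟨M, hM⟩ := (htop.eventually_gt_atTop (Real.log (C + 1))).exists
  classical
  refine ⟨(Finset.Ico (N + 1) (M + (N + 1))).filter fun p : ℕ ↦ p.Prime ∧ (p : ZMod q) = a,
    fun p hp ↦ ?_, ?_⟩
  · simp only [Finset.mem_filter, Finset.mem_Ico] at hp
    exact ⟨hp.2.1, hp.2.2, by omega⟩
  set P := (Finset.Ico (N + 1) (M + (N + 1))).filter fun p : ℕ ↦ p.Prime ∧ (p : ZMod q) = a with hPdef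
  have hP : ∀ p ∈ P, p.Prime := fun p hp ↦ (Finset.mem_filter.mp hp).2.1
  have hsum : ∑ p ∈ P, (p : ℝ)⁻¹ = ∑ n ∈ Finset.range M, g (n + (N + 1)) := by
    rw [hPdef, Finset.sum_filter, Finset.sum_Ico_eq_sum_range, Nat.add_sub_cancel]
    refine Finset.sum_congr rfl fun n _ ↦ ?_
    rw [add_comm n]
    simp [hg, Set.indicator]
  have hm : (0 : ℝ) < (∏ p ∈ P, p : ℕ) := mod_cast Finset.prod_pos fun p hp ↦ (hP p hp).pos
  have hexp : Real.exp (-∑ p ∈ P, (p : ℝ)⁻¹) < ((C : ℝ) + 1)⁻¹ := by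
    rw [Real.exp_neg]
    refine inv_strictAnti₀ (by positivity) ?_
    rw [hsum]
    exact (Real.log_lt_iff_lt_exp (by positivity)).mp hM
  have h := totient_prod_primes_le P hP
  have h2 : ((∏ p ∈ P, p).totient : ℝ) < (∏ p ∈ P, p : ℕ) * ((C : ℝ) + 1)⁻¹ :=
    h.trans_lt (mul_lt_mul_of_pos_left hexp hm)
  rw [← div_eq_mul_inv, lt_div_iff₀ (by positivity)] at h2
  have h3 : (∏ p ∈ P, p).totient * (C + 1) < ∏ p ∈ P, p := by exact_mod_cast h2
  nlinarith

open NumberTheorySymbols in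
theorem exists_jacobiSym_eq_neg_one_of_squarefree {s : ℕ} (hs : Squarefree s) (h1 : s ≠ 1) :
    ∃ b : ℕ, b % 4 = 1 ∧ J(s | b) = -1 := by
  have hs0 : s ≠ 0 := hs.ne_zero
  rcases Nat.even_or_odd s with he | ho
  · obtain ⟨k, rfl⟩ := he.two_dvd
    have hk : Nat.Coprime 2 k := Nat.coprime_of_squarefree_mul hs
    have hko : Odd k := Nat.coprime_two_left.mp hk
    have hc : Nat.Coprime 8 k := Nat.Coprime.pow_left 3 hk
    obtain ⟨b, hb8, hbk⟩ := Nat.chineseRemainder hc 5 1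
    have hb8' : b % 8 = 5 := hb8
    have hb4 : b % 4 = 1 := by omega
    refine ⟨b, hb4, ?_⟩
    have hbo : Odd b := Nat.odd_iff.mpr (by omega)
    push_cast
    rw [jacobiSym.mul_left, jacobiSym.at_two hbo, ZMod.χ₈_nat_mod_eight, hb8',
      jacobiSym.quadratic_reciprocity_one_mod_four' hko hb4, jacobiSym.mod_left,
      show ((b : ℤ) % k) = (1 : ℤ) % k by exact_mod_cast hbk, ← jacobiSym.mod_left,
      jacobiSym.one_left]
    decide
  · obtain ⟨p, hp, k, rfl⟩ := Nat.exists_prime_and_dvd h1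
    have := Fact.mk hp
    have hpo : Odd p := Nat.Odd.of_mul_left ho
    have hko : Odd k := Nat.Odd.of_mul_right ho
    have hpk : Nat.Coprime p k := Nat.coprime_of_squarefree_mul hs
    have hc : Nat.Coprime (4 * k) p :=
      Nat.Coprime.mul_left (Nat.Coprime.pow_left 2 (Nat.coprime_two_left.mpr hpo)) hpk.symm
    obtain ⟨r, hr⟩ := FiniteField.exists_nonsquare (F := ZMod p)
      (by rw [ZMod.ringChar_zmod_n]; rintro rfl; exact absurd hpo (by decide))
    obtain ⟨b, hb1, hb2⟩ := Nat.chineseRemainder hc 1 r.val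
    have hb4 : b % 4 = 1 := hb1.of_mul_right k
    have hbk : b ≡ 1 [MOD k] := hb1.of_mul_left 4
    refine ⟨b, hb4, ?_⟩
    rw [jacobiSym.quadratic_reciprocity_one_mod_four' ho hb4,
      jacobiSym.mul_right' _ hp.ne_zero (by rintro rfl; simp at hko),
      jacobiSym.mod_left b k,
      show ((b : ℤ) % k) = (1 : ℤ) % k by exact_mod_cast hbk, ← jacobiSym.mod_left,
      jacobiSym.one_left, mul_one, ZMod.nonsquare_iff_jacobiSym_eq_neg_one]
    have : (b : ZMod p) = r := by
      rw [(ZMod.natCast_eq_natCast_iff _ _ _).mpr hb2, ZMod.natCast_zmod_val]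
    simpa [this] using hr

open NumberTheorySymbols in
theorem exists_unit_forall_prime_not_isSquare {n : ℕ} (hn : ¬ IsSquare n) :
    ∃ a : ZMod (4 * n), IsUnit a ∧ ∀ p : ℕ, p.Prime → (p : ZMod (4 * n)) = a →
      p % 4 = 1 ∧ ¬ IsSquare (n : ZMod p) := by
  have hn0 : n ≠ 0 := by rintro rfl; exact hn ⟨0, rfl⟩
  obtain ⟨s, t, hst, hs⟩ := Nat.sq_mul_squarefree n
  have hs1 : s ≠ 1 := by rintro rfl; exact hn ⟨t, by rw [← hst]; ring⟩
  obtain ⟨b, hb4, hb⟩ := exists_jacobiSym_eq_neg_one_of_squarefree hs hs1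
  have hbo : Odd b := Nat.odd_iff.mpr (by omega)
  have hcop : b.Coprime (4 * s) := by
    refine Nat.Coprime.mul_right (Nat.Coprime.pow_right 2 (Nat.coprime_two_right.mpr hbo)) ?_
    by_contra h
    have : NeZero b := ⟨by rintro rfl; simp at hb4⟩
    rw [jacobiSym.eq_zero_iff_not_coprime.mpr (by rwa [Int.gcd_natCast_natCast, Nat.gcd_comm])]
      at hb
    simp at hb
  obtain ⟨l, hln, hl, hlb⟩ := Nat.forall_exists_prime_gt_and_modEq n
    (mul_ne_zero four_ne_zero hs.ne_zero) hcop
  have hl4 : l % 4 = 1 := by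
    have : l ≡ b [MOD 4] := hlb.of_mul_right s
    rw [← hb4]; exact this
  have hlo : Odd l := Nat.odd_iff.mpr (by omega)
  have hlt : l.Coprime n := (Nat.Prime.coprime_iff_not_dvd hl).mpr fun h ↦
    absurd (Nat.le_of_dvd (Nat.pos_of_ne_zero hn0) h) (by omega)
  have hJl : J(n | l) = -1 := by
    have ht : J(t | l) ^ 2 = 1 := by
      refine jacobiSym.sq_one ?_
      rw [Int.gcd_natCast_natCast]
      exact (hlt.coprime_dvd_right (hst ▸ (dvd_pow_self t two_ne_zero).mul_right s)).symm
    rw [← hst]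
    push_cast
    rw [jacobiSym.mul_left, jacobiSym.pow_left, ht, one_mul, jacobiSym.mod_right' s hlo,
      show l % (4 * s) = b % (4 * s) from hlb, ← jacobiSym.mod_right' s hbo, hb]
  refine ⟨(l : ZMod (4 * n)), ?_, fun p hp hpl ↦ ?_⟩
  · rw [ZMod.isUnit_iff_coprime]
    exact Nat.Coprime.mul_right (Nat.Coprime.pow_right 2 (Nat.coprime_two_right.mpr hlo)) hlt
  · have hmod : p ≡ l [MOD 4 * n] := (ZMod.natCast_eq_natCast_iff _ _ _).mp hpl
    have hp4 : p % 4 = 1 := by rw [← hl4]; exact hmod.of_mul_right n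
    refine ⟨hp4, ?_⟩
    have : J(n | p) = -1 := by
      rw [jacobiSym.mod_right' n (Nat.odd_iff.mpr (by omega)),
        show p % (4 * n) = l % (4 * n) from hmod, ← jacobiSym.mod_right' n hlo, hJl]
    exact_mod_cast ZMod.nonsquare_of_jacobiSym_eq_neg_one this

theorem ZMod.exists_isSquare_add_eq {p : ℕ} [Fact p.Prime] (h4 : p % 4 = 1) (h5 : 5 < p)
    (c : ZMod p) : ∃ a b : ZMod p, (a ≠ 0 ∧ IsSquare a) ∧ (b ≠ 0 ∧ IsSquare b) ∧ a + b = c := by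
  have hm1 : IsSquare (-1 : ZMod p) := ZMod.exists_sq_eq_neg_one_iff.mpr (by omega)
  have hne : ∀ k : ℕ, 0 < k → k < p → (k : ZMod p) ≠ 0 := fun k hk hkp h ↦
    absurd (Nat.le_of_dvd hk ((ZMod.natCast_eq_zero_iff k p).mp h)) (by omega)
  by_cases hc0 : c = 0
  · exact ⟨1, -1, ⟨one_ne_zero, ⟨1, by ring⟩⟩, ⟨neg_ne_zero.mpr one_ne_zero, hm1⟩, by simp [hc0]⟩
  by_cases hc : IsSquare c
  · obtain ⟨x, rfl⟩ := hc
    have hx : x ≠ 0 := by rintro rfl; simp at hc0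
    have e5 : (5 : ZMod p) ≠ 0 := by exact_mod_cast hne 5 (by omega) (by omega)
    have e3 : (3 : ZMod p) ≠ 0 := by exact_mod_cast hne 3 (by omega) (by omega)
    have e4 : (4 : ZMod p) ≠ 0 := by exact_mod_cast hne 4 (by omega) (by omega)
    refine ⟨(3 / 5 * x) * (3 / 5 * x), (4 / 5 * x) * (4 / 5 * x), ⟨?_, ⟨_, rfl⟩⟩,
      ⟨?_, ⟨_, rfl⟩⟩, ?_⟩
    · simp [hx, e5, e3]
    · simp [hx, e5, e4]
    · field_simp; ring
  · obtain ⟨x, y, hxy⟩ := ZMod.sq_add_sq p c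
    refine ⟨x ^ 2, y ^ 2, ⟨?_, ⟨x, by ring⟩⟩, ⟨?_, ⟨y, by ring⟩⟩, hxy⟩
    · intro h
      exact hc ⟨y, by rw [← hxy, h]; ring⟩
    · intro h
      exact hc ⟨x, by rw [← hxy, h]; ring⟩

theorem ZMod.exists_isSquare_sub_eq {p : ℕ} [Fact p.Prime] (h4 : p % 4 = 1) (h5 : 5 < p)
    (c : ZMod p) : ∃ a b : ZMod p, (a ≠ 0 ∧ IsSquare a) ∧ (b ≠ 0 ∧ IsSquare b) ∧ a - b = c := by
  have hm1 : IsSquare (-1 : ZMod p) := ZMod.exists_sq_eq_neg_one_iff.mpr (by omega)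
  obtain ⟨a, b, ha, hb, hab⟩ := ZMod.exists_isSquare_add_eq h4 h5 c
  exact ⟨a, -b, ha, ⟨neg_ne_zero.mpr hb.1, by simpa using hm1.mul hb.2⟩, by simpa using hab⟩

theorem linear_form_ne_zero_of_isSquare {F : Type*} [Field F] {u v n a b : F}
    (hm1 : IsSquare (-1 : F)) (hn : n = u * v ∨ n = -(u * v)) (hns : ¬ IsSquare n)
    (ha : a ≠ 0 ∧ IsSquare a) (hb : IsSquare b) : u * a + v * b ≠ 0 := by
  intro h
  have e : u * v = -1 * (v ^ 2 * (b / a)) := by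
    have := ha.1
    field_simp
    linear_combination v * h
  have huv : IsSquare (u * v) := by
    rw [e]
    exact hm1.mul ((IsSquare.sq v).mul (hb.div ha.2))
  rcases hn with rfl | rfl
  · exact hns huv
  · exact hns (by simpa using hm1.mul huv)

/-- Chinese remainder theorem: residues modulo distinct primes lift to one natural number. -/
theorem exists_lt_prod_forall_zmod_eq (P : Finset ℕ) (hP : ∀ p ∈ P, p.Prime)
    (f : ∀ p : ℕ, ZMod p) : ∃ k : ℕ, k < ∏ p ∈ P, p ∧ ∀ p ∈ P, (k : ZMod p) = f p := by
  have hco : Set.Pairwise (P : Set ℕ) (Function.onFun Nat.Coprime id) := fun p hp r hr hpr ↦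
    (Nat.coprime_primes (hP p hp) (hP r hr)).mpr hpr
  have hne : ∀ p ∈ P, id p ≠ 0 := fun p hp ↦ (hP p hp).ne_zero
  refine ⟨Nat.chineseRemainderOfFinset (fun p ↦ (f p).val) id P hne hco,
    Nat.chineseRemainderOfFinset_lt_prod _ _ hne hco, fun p hp ↦ ?_⟩
  have := Fact.mk (hP p hp)
  have := (Nat.chineseRemainderOfFinset (fun p ↦ (f p).val) id P hne hco).2 p hp
  rw [(ZMod.natCast_eq_natCast_iff _ _ _).mpr this, ZMod.natCast_zmod_val]

/-- An interval of length `L` holds at most `φ(m) (L / m + 1)` integers coprime to `m`. -/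
theorem card_le_totient_mul_of_coprime {m : ℕ} (hm : m ≠ 0) (S : Finset ℤ) (c L : ℕ)
    (hS : ∀ z ∈ S, -(m * c : ℤ) ≤ z ∧ z < -(m * c : ℤ) + L ∧ IsCoprime (m : ℤ) z) :
    S.card ≤ m.totient * (L / m + 1) := by
  have h := Nat.Ico_filter_coprime_le (a := m) 0 L hm
  refine le_trans (Finset.card_le_card_of_injOn (fun z : ℤ ↦ (z + m * c).toNat) ?_ ?_) h
  · intro z hz
    obtain ⟨h1, h2, h3⟩ := hS z hz
    simp only [Finset.coe_filter, Finset.mem_Ico, Set.mem_ofPred_eq]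
    refine ⟨by omega, ?_⟩
    rw [← Nat.isCoprime_iff_coprime, Int.toNat_of_nonneg (by omega)]
    exact IsCoprime.add_mul_left_right h3 c
  · intro z hz w hw hzw
    have h1 := (hS z hz).1
    have h2 := (hS w hw).1
    simp only at hzw
    omega

theorem stmt_17 (u v : ℤ) (h1 : 1 ≤ |v|) (h2 : |v| ≤ u) (h3 : Int.gcd u v = 1)
    (hsq : ¬ IsSquare |u * v|) :
    (∃ A : Finset ℤ, (binFormImage u v A).card < (A + A).card) ∧
    (∃ A' : Finset ℤ, (binFormImage u v A').card < (A' - A').card) := by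
  classical
  have hn : ¬ IsSquare (u * v).natAbs := by
    rintro ⟨k, hk⟩
    exact hsq ⟨k, by rw [Int.abs_eq_natAbs, hk]; push_cast; rfl⟩
  have : NeZero (4 * (u * v).natAbs) :=
    ⟨mul_ne_zero four_ne_zero fun h ↦ hn (h ▸ ⟨0, rfl⟩)⟩
  obtain ⟨a, ha, hap⟩ := exists_unit_forall_prime_not_isSquare hn
  obtain ⟨P, hP, hlt⟩ := exists_primes_residueClass_mul_totient_lt ha 5
    (2 * (u.natAbs + 2 * v.natAbs) + 1)
  have hprime : ∀ p ∈ P, p.Prime := fun p hp ↦ (hP p hp).1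
  set m := ∏ p ∈ P, p with hm
  have hm0 : 0 < m := Finset.prod_pos fun p hp ↦ (hprime p hp).pos
  set A : Finset ℤ := (Finset.Ico 0 (2 * m : ℤ)).filter
    fun z ↦ ∀ p ∈ P, (z : ZMod p) ≠ 0 ∧ IsSquare (z : ZMod p) with hA
  have hmem (z : ℤ) : z ∈ A ↔ (0 ≤ z ∧ z < 2 * m) ∧
      ∀ p ∈ P, (z : ZMod p) ≠ 0 ∧ IsSquare (z : ZMod p) := by
    rw [hA, Finset.mem_filter, Finset.mem_Ico]
  have hform : (binFormImage u v A).card < m := by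
    refine lt_of_le_of_lt (card_le_totient_mul_of_coprime hm0.ne' _ (2 * v.natAbs)
      (m * (2 * (u.natAbs + 2 * v.natAbs))) ?_) ?_
    · intro z hz
      obtain ⟨⟨x, y⟩, hxy, rfl⟩ := Finset.mem_image.mp hz
      obtain ⟨hx, hy⟩ := Finset.mem_product.mp hxy
      obtain ⟨⟨hx0, hx1⟩, hxP⟩ := (hmem x).mp hx
      obtain ⟨⟨hy0, hy1⟩, hyP⟩ := (hmem y).mp hy
      have hux : 0 ≤ u * x := mul_nonneg (by linarith) hx0
      have hux' : u * x < u * (2 * m) := mul_lt_mul_of_pos_left hx1 (by linarith)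
      have hvy : |v * y| ≤ |v| * (2 * m) := by
        rw [abs_mul, abs_of_nonneg hy0]
        gcongr
      obtain ⟨hvy1, hvy2⟩ := abs_le.mp hvy
      push_cast
      rw [abs_of_nonneg (by linarith : 0 ≤ u)]
      refine ⟨by linarith, by linarith, ?_⟩
      rw [hm]
      push_cast
      refine IsCoprime.prod_left fun p hp ↦ ?_
      have := Fact.mk (hprime p hp)
      obtain ⟨hp4, hpn⟩ := hap p (hprime p hp) (hP p hp).2.1
      rw [(Nat.prime_iff_prime_int.mp (hprime p hp)).coprime_iff_not_dvd,
        ← ZMod.intCast_zmod_eq_zero_iff_dvd]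
      push_cast
      refine linear_form_ne_zero_of_isSquare (n := ((u * v).natAbs : ZMod p))
        (ZMod.exists_sq_eq_neg_one_iff.mpr (by omega)) ?_ hpn (hxP p hp) (hyP p hp).2
      rcases Int.natAbs_eq (u * v) with h | h
      · left
        have := congrArg (Int.cast : ℤ → ZMod p) h
        rw [Int.cast_natCast] at this
        rw [← this, Int.cast_mul]
      · right
        have := congrArg (Int.cast : ℤ → ZMod p) h
        rw [Int.cast_neg, Int.cast_natCast] at this
        rw [← Int.cast_mul, this, neg_neg]
    · rw [Nat.mul_div_cancel_left _ hm0, mul_comm]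
      exact hlt
  refine ⟨⟨A, hform.trans_le ?_⟩, ⟨A, hform.trans_le ?_⟩⟩
  · have hsub : Finset.Ico (m : ℤ) (2 * m) ⊆ A + A := by
      intro z hz
      rw [Finset.mem_Ico] at hz
      have hloc (p : ℕ) : ∃ r : ZMod p, p ∈ P →
          (r ≠ 0 ∧ IsSquare r) ∧ (z - r ≠ 0 ∧ IsSquare (z - r)) := by
        by_cases hp : p ∈ P
        · have := Fact.mk (hprime p hp)
          obtain ⟨r, s, hr, hs, hrs⟩ := ZMod.exists_isSquare_add_eq
            (hap p (hprime p hp) (hP p hp).2.1).1 (hP p hp).2.2 (z : ZMod p)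
          exact ⟨r, fun _ ↦ ⟨hr, by rwa [← hrs, add_sub_cancel_left]⟩⟩
        · exact ⟨0, fun h ↦ absurd h hp⟩
      choose f hf using hloc
      obtain ⟨k, hk, hkf⟩ := exists_lt_prod_forall_zmod_eq P hprime f
      refine Finset.mem_add.mpr ⟨k, (hmem _).mpr ⟨by omega, fun p hp ↦ ?_⟩, z - k,
        (hmem _).mpr ⟨by omega, fun p hp ↦ ?_⟩, by ring⟩
      · rw [Int.cast_natCast, hkf p hp]
        exact (hf p hp).1
      · rw [Int.cast_sub, Int.cast_natCast, hkf p hp]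
        exact (hf p hp).2
    refine le_trans (le_of_eq ?_) (Finset.card_le_card hsub)
    rw [Int.card_Ico]
    omega
  · have hsub : Finset.Ico 0 (m : ℤ) ⊆ A - A := by
      intro z hz
      rw [Finset.mem_Ico] at hz
      have hloc (p : ℕ) : ∃ r : ZMod p, p ∈ P →
          (r ≠ 0 ∧ IsSquare r) ∧ (z + r ≠ 0 ∧ IsSquare (z + r)) := by
        by_cases hp : p ∈ P
        · have := Fact.mk (hprime p hp)
          obtain ⟨s, r, hs, hr, hrs⟩ := ZMod.exists_isSquare_sub_eq
            (hap p (hprime p hp) (hP p hp).2.1).1 (hP p hp).2.2 (z : ZMod p)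
          exact ⟨r, fun _ ↦ ⟨hr, by rwa [← hrs, sub_add_cancel]⟩⟩
        · exact ⟨0, fun h ↦ absurd h hp⟩
      choose f hf using hloc
      obtain ⟨k, hk, hkf⟩ := exists_lt_prod_forall_zmod_eq P hprime f
      refine Finset.mem_sub.mpr ⟨z + k, (hmem _).mpr ⟨by omega, fun p hp ↦ ?_⟩, k,
        (hmem _).mpr ⟨by omega, fun p hp ↦ ?_⟩, by ring⟩
      · rw [Int.cast_add, Int.cast_natCast, hkf p hp]
        exact (hf p hp).2
      · rw [Int.cast_natCast, hkf p hp]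
        exact (hf p hp).1
    refine le_trans (le_of_eq ?_) (Finset.card_le_card hsub)
    rw [Int.card_Ico]
    omega
end

section
/- Let u and v be relatively prime integers with u > |v| ≥ 1, and let f(x,y) = ux + vy. Then there exist finite sets A and A' of integers such that |f(A)| < |A + A| and |f(A')| < |A' − A'|. -/
open Pointwise

/-- The sums `∑ cᵢ uⁱ v^(K-i)` with digits `0 ≤ cᵢ ≤ bᵢ`, for `i < K`. -/
def digitSums (u v : ℤ) {K : ℕ} (b : Fin K → ℕ) : Finset ℤ :=
  (Fintype.piFinset fun i => Finset.range (b i + 1)).image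
    fun c => ∑ i : Fin K, (c i : ℤ) * (u ^ (i : ℕ) * v ^ (K - (i : ℕ)))

lemma mem_digitSums {u v : ℤ} {K : ℕ} {b : Fin K → ℕ} {x : ℤ} :
    x ∈ digitSums u v b ↔ ∃ c : Fin K → ℕ, (∀ i, c i ≤ b i) ∧
      ∑ i, (c i : ℤ) * (u ^ (i : ℕ) * v ^ (K - (i : ℕ))) = x := by
  simp [digitSums]

lemma card_digitSums_le (u v : ℤ) {K : ℕ} (b : Fin K → ℕ) :
    (digitSums u v b).card ≤ ∏ i, (b i + 1) := by
  refine Finset.card_image_le.trans ?_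
  simp [Fintype.card_piFinset]

/-- Multiplication by `u` shifts the digits by one place relative to multiplication by `v`. -/
lemma mul_add_mul_mem_digitSums {u v : ℤ} {K : ℕ} {b b' : Fin K → ℕ} {x y : ℤ}
    (hx : x ∈ digitSums u v b) (hy : y ∈ digitSums u v b') :
    u * x + v * y ∈ digitSums u v
      (fun j => (Fin.cons 0 b : Fin (K + 1) → ℕ) j + (Fin.snoc b' 0 : Fin (K + 1) → ℕ) j) := by
  obtain ⟨c, hc, rfl⟩ := mem_digitSums.1 hx
  obtain ⟨d, hd, rfl⟩ := mem_digitSums.1 hy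
  refine mem_digitSums.2 ⟨fun j => (Fin.cons 0 c : Fin (K + 1) → ℕ) j +
    (Fin.snoc d 0 : Fin (K + 1) → ℕ) j, fun j => add_le_add ?_ ?_, ?_⟩
  · refine Fin.cases ?_ (fun i => ?_) j
    · simp
    · simpa using hc i
  · refine Fin.lastCases ?_ (fun i => ?_) j
    · simp
    · simpa using hd i
  · simp only [Nat.cast_add, add_mul, Finset.sum_add_distrib]
    congr 1
    · rw [Fin.sum_univ_succ, Finset.mul_sum]
      simp only [Fin.cons_zero, Fin.cons_succ, Fin.val_succ, Nat.add_sub_add_right]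
      simp only [Nat.cast_zero, zero_mul, zero_add]
      exact Finset.sum_congr rfl fun i _ => by ring
    · rw [Fin.sum_univ_castSucc, Finset.mul_sum]
      simp only [Fin.snoc_last, Fin.snoc_castSucc, Fin.val_castSucc]
      simp only [Nat.cast_zero, zero_mul, add_zero]
      refine Finset.sum_congr rfl fun i _ => ?_
      rw [Nat.succ_sub i.isLt.le, pow_succ]
      ring

/-- Expansions in the mixed powers `uⁱ v^(K-i)` with digits smaller than `u` are unique. -/
lemma eq_zero_of_sum_mul_pow_eq_zero {u v : ℤ} (hu : 0 < u) (huv : IsCoprime u v) :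
    ∀ {K : ℕ} (d : Fin K → ℤ), (∀ i, |d i| < u) →
      ∑ i, d i * (u ^ (i : ℕ) * v ^ (K - (i : ℕ))) = 0 → ∀ i, d i = 0 := by
  intro K
  induction K with
  | zero => exact fun d _ _ i => i.elim0
  | succ K ih =>
    intro d hd h
    have key : d 0 * v ^ (K + 1) +
        u * ∑ i : Fin K, d i.succ * (u ^ (i : ℕ) * v ^ (K - (i : ℕ))) = 0 := by
      rw [← h, Fin.sum_univ_succ, Finset.mul_sum]
      simp only [Fin.val_succ, Nat.add_sub_add_right, Fin.val_zero, pow_zero, one_mul,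
        Nat.sub_zero]
      exact congrArg _ (Finset.sum_congr rfl fun i _ => by ring)
    have hdvd : u ∣ d 0 * v ^ (K + 1) := by
      rw [eq_neg_of_add_eq_zero_left key]
      exact (dvd_mul_right _ _).neg_right
    have h0 : d 0 = 0 :=
      Int.eq_zero_of_abs_lt_dvd (huv.pow_right.dvd_of_dvd_mul_right hdvd) (hd 0)
    rw [h0, zero_mul, zero_add] at key
    have hs := ih (fun i => d i.succ) (fun i => hd _)
      ((mul_eq_zero.1 key).resolve_left hu.ne')
    exact fun i => Fin.cases h0 hs i

/-- The places `i < K` with `i ≡ 0, 1` (for `s = true`) or `i ≡ 2, 3` (for `s = false`)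
modulo `4`, as a `0`-`1` bound on digits. -/
def blockBound (K : ℕ) (s : Bool) (i : Fin K) : ℕ :=
  if decide ((i : ℕ) % 4 < 2) = s then 1 else 0

/-- The `0`-`1` digit sums supported on one of the two families of blocks. -/
def blockSums (u v : ℤ) (K : ℕ) : Finset ℤ :=
  Finset.univ.biUnion fun s : Bool => digitSums u v (blockBound K s)

lemma card_binFormImage_blockSums_le (u v : ℤ) (K : ℕ) :
    (binFormImage u v (blockSums u v K)).card ≤
      ∑ p : Bool × Bool, ∏ j : Fin (K + 1),
        ((Fin.cons 0 (blockBound K p.1) : Fin (K + 1) → ℕ) j +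
          (Fin.snoc (blockBound K p.2) 0 : Fin (K + 1) → ℕ) j + 1) := by
  have hsub : binFormImage u v (blockSums u v K) ⊆
      Finset.univ.biUnion fun p : Bool × Bool => digitSums u v
        (fun j => (Fin.cons 0 (blockBound K p.1) : Fin (K + 1) → ℕ) j +
          (Fin.snoc (blockBound K p.2) 0 : Fin (K + 1) → ℕ) j) := by
    intro z hz
    obtain ⟨⟨x, y⟩, hxy, rfl⟩ := Finset.mem_image.1 hz
    obtain ⟨hx, hy⟩ := Finset.mem_product.1 hxy
    obtain ⟨s, -, hs⟩ := Finset.mem_biUnion.1 hx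
    obtain ⟨t, -, ht⟩ := Finset.mem_biUnion.1 hy
    exact Finset.mem_biUnion.2 ⟨(s, t), Finset.mem_univ _, mul_add_mul_mem_digitSums hs ht⟩
  exact (Finset.card_le_card hsub).trans
    (Finset.card_biUnion_le.trans (Finset.sum_le_sum fun p _ => card_digitSums_le u v _))

lemma card_binFormImage_blockSums_lt (u v : ℤ) :
    (binFormImage u v (blockSums u v 24)).card < 2 ^ 24 :=
  (card_binFormImage_blockSums_le u v 24).trans_lt (by
    simp [Fintype.sum_prod_type, Fin.prod_univ_succ, Fin.snoc, blockBound])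

/-- If `B` contains `x + ε y` for all `x, y` in `blockSums u v K`, where `ε = ±1`, then `B` has
at least `2 ^ K` elements. -/
lemma two_pow_le_card_of_blockSums {u v : ℤ} (hu : 1 < u) (huv : IsCoprime u v) (K : ℕ)
    {ε : ℤ} (hε : |ε| = 1) {B : Finset ℤ}
    (hB : ∀ x ∈ blockSums u v K, ∀ y ∈ blockSums u v K, x + ε * y ∈ B) :
    2 ^ K ≤ B.card := by
  let sgn : Fin K → ℤ := fun i => if (i : ℕ) % 4 < 2 then 1 else ε
  have hsgn : ∀ i, |sgn i| = 1 := fun i => by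
    simp only [sgn]; split_ifs <;> simp [hε]
  have hcard : (Fintype.piFinset fun _ : Fin K => Finset.range 2).card = 2 ^ K := by simp
  rw [← hcard]
  refine Finset.card_le_card_of_injOn
    (fun c : Fin K → ℕ => ∑ i : Fin K, ((c i : ℤ) * sgn i) * (u ^ (i : ℕ) * v ^ (K - (i : ℕ)))) ?_ ?_
  · intro c hc
    have hc' : ∀ i, c i ≤ 1 := fun i =>
      Nat.lt_succ_iff.1 (Finset.mem_range.1 (Fintype.mem_piFinset.1 hc i))
    have hmem : ∀ s, ∑ i : Fin K, ((c i * blockBound K s i : ℕ) : ℤ) *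
        (u ^ (i : ℕ) * v ^ (K - (i : ℕ))) ∈ blockSums u v K := fun s =>
      Finset.mem_biUnion.2 ⟨s, Finset.mem_univ _, mem_digitSums.2
        ⟨fun i => c i * blockBound K s i,
          fun i => by simpa using Nat.mul_le_mul_right (blockBound K s i) (hc' i), rfl⟩⟩
    rw [Finset.mem_coe]
    convert hB _ (hmem true) _ (hmem false) using 1
    rw [Finset.mul_sum, ← Finset.sum_add_distrib]
    refine Finset.sum_congr rfl fun i _ => ?_
    by_cases hi : (i : ℕ) % 4 < 2
    · simp only [sgn, blockBound, hi, decide_true, if_true, reduceCtorEq, if_false]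
      push_cast
      ring
    · simp only [sgn, blockBound, hi, decide_false, if_true, reduceCtorEq, if_false]
      push_cast
      ring
  · intro c hc c' hc' h
    have hlt : ∀ i, c i < 2 ∧ c' i < 2 := fun i =>
      ⟨Finset.mem_range.1 (Fintype.mem_piFinset.1 hc i),
        Finset.mem_range.1 (Fintype.mem_piFinset.1 hc' i)⟩
    have hz := eq_zero_of_sum_mul_pow_eq_zero (by omega) huv
      (fun i => ((c i : ℤ) - c' i) * sgn i) (fun i => by
        rw [abs_mul, hsgn, mul_one, abs_lt]
        have := hlt i
        omega) (by
        simp only [sub_mul, Finset.sum_sub_distrib]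
        exact sub_eq_zero.2 h)
    funext i
    have hne : sgn i ≠ 0 := fun h0 => by simpa [h0] using hsgn i
    have := (mul_eq_zero.1 (hz i)).resolve_right hne
    omega

lemma two_pow_le_card_blockSums_add {u v : ℤ} (hu : 1 < u) (huv : IsCoprime u v) (K : ℕ) :
    2 ^ K ≤ (blockSums u v K + blockSums u v K).card :=
  two_pow_le_card_of_blockSums hu huv K (ε := 1) (by simp) fun x hx y hy => by
    simpa using Finset.add_mem_add hx hy

lemma two_pow_le_card_blockSums_sub {u v : ℤ} (hu : 1 < u) (huv : IsCoprime u v) (K : ℕ) :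
    2 ^ K ≤ (blockSums u v K - blockSums u v K).card :=
  two_pow_le_card_of_blockSums hu huv K (ε := -1) (by simp) fun x hx y hy => by
    simpa [sub_eq_add_neg] using Finset.sub_mem_sub hx hy

theorem stmt_19 (u v : ℤ) (h1 : 1 ≤ |v|) (h2 : |v| < u) (h3 : Int.gcd u v = 1) :
    (∃ A : Finset ℤ, (binFormImage u v A).card < (A + A).card) ∧
    (∃ A' : Finset ℤ, (binFormImage u v A').card < (A' - A').card) := by
  have hu : 1 < u := h1.trans_lt h2
  have huv : IsCoprime u v := Int.isCoprime_iff_gcd_eq_one.2 h3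
  have hlt := card_binFormImage_blockSums_lt u v
  exact ⟨⟨_, hlt.trans_le (two_pow_le_card_blockSums_add hu huv 24)⟩,
    ⟨_, hlt.trans_le (two_pow_le_card_blockSums_sub hu huv 24)⟩⟩
end
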